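/- The function h defined on (0, ∞) by h(x) = log((1 − e^{−x})/x) is differentiable on (0, ∞) with derivative h'(x) = e^{−x}/(1 − e^{−x}) − 1/x, and this derivative satisfies −1/2 ≤ h'(x) ≤ 0 for every x > 0. -/

import Mathlib

theorem aux_key (x : ℝ) : (1 + x) * Real.exp (-x) ≤ 1 := by
  have h := Real.add_one_le_exp x
  have h2 : Real.exp x * Real.exp (-x) = 1 := by rw [← Real.exp_add]; simp
  nlinarith [Real.exp_pos (-x)]

theorem aux_lower (x : ℝ) (hx : 0 < x) : 0 ≤ Real.exp (-x) * (2 + x) + x - 2 := by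
  have hd : ∀ y : ℝ, HasDerivAt (fun y : ℝ => Real.exp (-y) * (2 + y) + y - 2)
      (1 - (1 + y) * Real.exp (-y)) y := by
    intro y
    have h1 : HasDerivAt (fun y : ℝ => Real.exp (-y)) (Real.exp (-y) * (-1)) y :=
      (hasDerivAt_id y).neg.exp
    have h2 : HasDerivAt (fun y : ℝ => 2 + y) 1 y := (hasDerivAt_id y).const_add 2
    have h3 : HasDerivAt (fun y : ℝ => Real.exp (-y) * (2 + y) + y - 2)
        (Real.exp (-y) * (-1) * (2 + y) + Real.exp (-y) * 1 + 1) y :=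
      ((h1.mul h2).add (hasDerivAt_id y)).sub_const 2
    exact h3.congr_deriv (by ring)
  have hm : Monotone (fun y : ℝ => Real.exp (-y) * (2 + y) + y - 2) := by
    apply monotone_of_deriv_nonneg (fun y => (hd y).differentiableAt)
    intro y
    rw [(hd y).deriv]
    simpa using aux_key y
  have := hm hx.le
  norm_num at this
  linarith

theorem h_hasDerivAt_and_deriv_bounds (x : ℝ) (hx : 0 < x) :
    HasDerivAt (fun x : ℝ => Real.log ((1 - Real.exp (-x)) / x))
        (Real.exp (-x) / (1 - Real.exp (-x)) - 1 / x) x ∧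
      -(1 / 2) ≤ Real.exp (-x) / (1 - Real.exp (-x)) - 1 / x ∧
      Real.exp (-x) / (1 - Real.exp (-x)) - 1 / x ≤ 0 := by
  have he : 0 < 1 - Real.exp (-x) := by
    have : Real.exp (-x) < 1 := by rw [Real.exp_lt_one_iff]; linarith
    linarith
  refine ⟨?_, ?_, ?_⟩
  · have h1 : HasDerivAt (fun y : ℝ => Real.exp (-y)) (Real.exp (-x) * (-1)) x :=
      (hasDerivAt_id x).neg.exp
    have h2 : HasDerivAt (fun y : ℝ => Real.log ((1 - Real.exp (-y)) / y))
        ((-(Real.exp (-x) * (-1)) * x - (1 - Real.exp (-x)) * 1) / x ^ 2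
          / ((1 - Real.exp (-x)) / x)) x :=
      ((h1.const_sub 1).div (hasDerivAt_id x) hx.ne').log (div_pos he hx).ne'
    refine h2.congr_deriv ?_
    have := he.ne'
    field_simp
  · have h := aux_lower x hx
    have : Real.exp (-x) / (1 - Real.exp (-x)) - 1 / x + 1 / 2 =
        (Real.exp (-x) * (2 + x) + x - 2) / (2 * x * (1 - Real.exp (-x))) := by
      have := he.ne'
      field_simp
      ring
    have h3 : 0 ≤ (Real.exp (-x) * (2 + x) + x - 2) / (2 * x * (1 - Real.exp (-x))) := by
      positivity
    linarith
  · rw [sub_nonpos, div_le_div_iff₀ he hx]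
    linarith [aux_key x]
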